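/- Let q, T ≥ 2 and set Z = qT/2^{ω(q)}. Then R₁ := φ(q)·T · Σ (1/√(abcd)) · (1 + ab/(qT))^{−2} · (1 + cd/(qT))^{−2}, where the sum runs over positive integers a, b, c, d with ab > Z, cd > Z, ac = bd and gcd(abcd, q) = 1, satisfies R₁ ≪ qT·(φ(q)/q)^5·ω(q)²·(log qT)² + φ(q)·T·log qT, with an absolute implied constant. -/

import Mathlib

open scoped Classical in
/-- `R₁ = φ(q) T ∑_{ab,cd > Z, ac = bd, (abcd,q)=1}`
`(abcd)^{-1/2} (1 + ab/(qT))⁻² (1 + cd/(qT))⁻²`. -/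
noncomputable def R1 (q : ℕ) (Z T : ℝ) : ℝ :=
  (q.totient : ℝ) * T *
    ∑' p : ℕ+ × ℕ+ × ℕ+ × ℕ+,
      let a : ℕ := p.1; let b : ℕ := p.2.1; let c : ℕ := p.2.2.1; let d : ℕ := p.2.2.2
      if Z < ((a * b : ℕ) : ℝ) ∧ Z < ((c * d : ℕ) : ℝ) ∧
          a * c = b * d ∧ Nat.gcd (a * b * c * d) q = 1 then
        1 / Real.sqrt (a * b * c * d) *
          (1 + ((a * b : ℕ) : ℝ) / (q * T)) ^ (-2 : ℤ) *
          (1 + ((c * d : ℕ) : ℝ) / (q * T)) ^ (-2 : ℤ)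
      else 0

theorem sum_range_rpow_le {σ : ℝ} (hσ : 0 < σ) (k : ℕ) :
    ∑ n ∈ Finset.range (k + 1), ((n + 1 : ℕ) : ℝ) ^ (-(1 + σ)) ≤
      1 + 1 / σ - ((k + 1 : ℕ) : ℝ) ^ (-σ) / σ := by
  induction k with
  | zero => simp
  | succ k ih =>
    rw [Finset.sum_range_succ]
    have hk : (0 : ℝ) < (k + 1 : ℕ) := by positivity
    have hk2 : (0 : ℝ) < (k + 1 + 1 : ℕ) := by positivity
    have key : ((k + 1 + 1 : ℕ) : ℝ) ^ (-σ) * (1 + σ / (k + 1 + 1 : ℕ)) ≤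
        ((k + 1 : ℕ) : ℝ) ^ (-σ) := by
      have h1 : ((k + 1 : ℕ) : ℝ) ^ (-σ) = ((k + 1 + 1 : ℕ) : ℝ) ^ (-σ) *
          (((k + 1 : ℕ) : ℝ) / (k + 1 + 1 : ℕ)) ^ (-σ) := by
        rw [← Real.mul_rpow (by positivity) (by positivity)]
        congr 1
        field_simp
      rw [h1]
      gcongr
      rw [Real.rpow_def_of_pos (by positivity)]
      have h2 := Real.log_le_sub_one_of_pos
        (show (0 : ℝ) < ((k + 1 : ℕ) : ℝ) / (k + 1 + 1 : ℕ) by positivity)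
      have h3 : ((k + 1 : ℕ) : ℝ) / (k + 1 + 1 : ℕ) - 1 = -(1 / (k + 1 + 1 : ℕ)) := by
        field_simp
        push_cast
        ring
      rw [h3] at h2
      have h4 := Real.add_one_le_exp
        (Real.log (((k + 1 : ℕ) : ℝ) / (k + 1 + 1 : ℕ)) * -σ)
      have h5 : σ / (k + 1 + 1 : ℕ) = 1 / (k + 1 + 1 : ℕ) * σ := by ring
      nlinarith
    have h6 : ((k + 1 + 1 : ℕ) : ℝ) ^ (-(1 + σ)) =
        ((k + 1 + 1 : ℕ) : ℝ) ^ (-σ) / (k + 1 + 1 : ℕ) := by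
      rw [neg_add, Real.rpow_add hk2, Real.rpow_neg_one]
      ring
    have h7 : ((k + 1 + 1 : ℕ) : ℝ) ^ (-σ) / (k + 1 + 1 : ℕ) ≤
        (((k + 1 : ℕ) : ℝ) ^ (-σ) - ((k + 1 + 1 : ℕ) : ℝ) ^ (-σ)) / σ := by
      rw [le_div_iff₀ hσ]
      have : ((k + 1 + 1 : ℕ) : ℝ) ^ (-σ) / (k + 1 + 1 : ℕ) * σ =
        ((k + 1 + 1 : ℕ) : ℝ) ^ (-σ) * (σ / (k + 1 + 1 : ℕ)) := by ring
      linarith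
    rw [h6]
    rw [sub_div] at h7
    linarith

theorem tsum_rpow_le {σ : ℝ} (hσ : 0 < σ) :
    ∑' n : ℕ, (n : ℝ) ^ (-(1 + σ)) ≤ 1 + 1 / σ := by
  refine Real.tsum_le_of_sum_range_le (fun n => by positivity) fun k => ?_
  rcases k with _ | _ | k
  · simp; positivity
  · have h0 : ((0 : ℕ) : ℝ) ^ (-(1 + σ)) = 0 := by
      rw [Nat.cast_zero, Real.zero_rpow (by linarith)]
    rw [zero_add, Finset.sum_range_one, h0]
    positivity
  · rw [Finset.sum_range_succ']
    have h0 : ((0 : ℕ) : ℝ) ^ (-(1 + σ)) = 0 := by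
      rw [Nat.cast_zero, Real.zero_rpow (by linarith)]
    rw [h0, add_zero]
    refine (sum_range_rpow_le hσ k).trans ?_
    have : 0 ≤ ((k + 1 : ℕ) : ℝ) ^ (-σ) / σ := by positivity
    linarith

theorem forall_not_dvd_prime_mul_iff {p : ℕ} {P : Finset ℕ} (hpp : p.Prime) (hp : p ∉ P)
    (hP : ∀ r ∈ P, r.Prime) (m : ℕ) : (∀ r ∈ P, ¬ r ∣ p * m) ↔ ∀ r ∈ P, ¬ r ∣ m := by
  refine forall₂_congr fun r hr => not_congr ?_
  rw [(hP r hr).dvd_mul, or_iff_right]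
  intro h
  rw [Nat.prime_dvd_prime_iff_eq (hP r hr) hpp] at h
  exact hp (h ▸ hr)

open scoped Classical in
theorem hasSum_rpow_sifted {s : ℝ} (hs : 1 < s) (P : Finset ℕ) (hP : ∀ p ∈ P, p.Prime) :
    HasSum (fun n : ℕ => if ∀ p ∈ P, ¬ p ∣ n then (n : ℝ) ^ (-s) else 0)
      ((∏ p ∈ P, (1 - (p : ℝ) ^ (-s))) * ∑' n : ℕ, (n : ℝ) ^ (-s)) := by
  induction P using Finset.induction_on with
  | empty =>
    simpa using (Real.summable_nat_rpow.2 (by linarith : -s < -1)).hasSum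
  | insert p P hp ih =>
    have hpp := hP p (Finset.mem_insert_self p P)
    have ih := ih fun r hr => hP r (Finset.mem_insert_of_mem hr)
    have hinj : Function.Injective (fun m : ℕ => p * m) :=
      fun a b h => Nat.eq_of_mul_eq_mul_left hpp.pos h
    have hmul : HasSum (fun n : ℕ => if p ∣ n then
        (if ∀ r ∈ P, ¬ r ∣ n then (n : ℝ) ^ (-s) else 0) else 0)
        ((p : ℝ) ^ (-s) * ((∏ r ∈ P, (1 - (r : ℝ) ^ (-s))) * ∑' n : ℕ, (n : ℝ) ^ (-s))) := by
      rw [← hinj.hasSum_iff]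
      · have e : (fun n : ℕ => if p ∣ n then
            (if ∀ r ∈ P, ¬ r ∣ n then (n : ℝ) ^ (-s) else 0) else 0) ∘ (fun m : ℕ => p * m) =
            fun m : ℕ => (p : ℝ) ^ (-s) * if ∀ r ∈ P, ¬ r ∣ m then (m : ℝ) ^ (-s) else 0 := by
          funext m
          have h1 := forall_not_dvd_prime_mul_iff hpp hp
            (fun r hr => hP r (Finset.mem_insert_of_mem hr)) m
          simp only [Function.comp_apply, dvd_mul_right, if_true, h1, mul_ite, mul_zero]
          rw [Nat.cast_mul, Real.mul_rpow (by positivity) (by positivity)]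
        rw [e]
        exact ih.mul_left _
      · intro n hn
        rw [if_neg]
        rintro ⟨m, rfl⟩
        exact hn ⟨m, rfl⟩
    have e : (fun n : ℕ => if ∀ r ∈ insert p P, ¬ r ∣ n then (n : ℝ) ^ (-s) else 0) =
        fun n : ℕ => (if ∀ r ∈ P, ¬ r ∣ n then (n : ℝ) ^ (-s) else 0) -
          if p ∣ n then (if ∀ r ∈ P, ¬ r ∣ n then (n : ℝ) ^ (-s) else 0) else 0 := by
      funext n
      by_cases h1 : p ∣ n <;> simp [h1]
    rw [e, Finset.prod_insert hp, sub_mul, sub_mul, one_mul, mul_assoc]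
    exact ih.sub hmul

theorem one_sub_rpow_le {p σ : ℝ} (hp : 2 ≤ p) (hσ : 0 < σ) :
    1 - p ^ (-(1 + σ)) ≤ (1 - 1 / p) * Real.exp (2 * (σ * Real.log p)  / p) := by
  have hp0 : 0 < p := by linarith
  have h1 : p ^ (-(1 + σ)) = p ^ (-σ) / p := by
    rw [neg_add, Real.rpow_add hp0, Real.rpow_neg_one]
    ring
  have h2 : 1 - σ * Real.log p ≤ p ^ (-σ) := by
    rw [Real.rpow_def_of_pos hp0]
    have := Real.add_one_le_exp (Real.log p * -σ)
    linarith
  have h3 := Real.add_one_le_exp (2 * (σ * Real.log p)  / p)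
  have h4 : 1 / p ≤ 1 / 2 := one_div_le_one_div_of_le (by norm_num) hp
  have h5 : 0 ≤ σ * Real.log p := mul_nonneg hσ.le (Real.log_nonneg (by linarith))
  calc 1 - p ^ (-(1 + σ)) = 1 - p ^ (-σ) * (1 / p) := by rw [h1]; ring
    _ ≤ 1 - (1 - σ * Real.log p) * (1 / p) := by gcongr
    _ ≤ (1 - 1 / p) * (2 * (σ * Real.log p) / p + 1) := by
      have : 2 * (σ * Real.log p) / p = 2 * (σ * Real.log p) * (1 / p) := by ring
      rw [this]
      have : 0 ≤ (1/p) * (σ * Real.log p) := by positivity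
      nlinarith
    _ ≤ _ := by gcongr; linarith

theorem totient_div_eq_prod {q : ℕ} (hq : q ≠ 0) :
    (q.totient : ℝ) / q = ∏ p ∈ q.primeFactors, (1 - 1 / (p : ℝ)) := by
  have h : (q.totient : ℝ) = q * ∏ p ∈ q.primeFactors, (1 - 1 / (p : ℝ)) := by
    have := congrArg (fun x : ℚ => (x : ℝ)) (Nat.totient_eq_mul_prod_factors q)
    simpa using this
  rw [h]
  field_simp

theorem coprime_iff_forall_primeFactors {n q : ℕ} (hq : q ≠ 0) :
    n.Coprime q ↔ ∀ p ∈ q.primeFactors, ¬ p ∣ n := by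
  constructor
  · intro h p hp hpn
    exact Nat.not_coprime_of_dvd_of_dvd (Nat.prime_of_mem_primeFactors hp).one_lt hpn
      (Nat.dvd_of_mem_primeFactors hp) h
  · intro h
    refine Nat.coprime_of_dvd fun p hp hpn hpq => h p ?_ hpn
    exact Nat.mem_primeFactors.2 ⟨hp, hpq, hq⟩

open scoped Classical in
theorem tsum_coprime_rpow_le {q : ℕ} (hq : q ≠ 0) {σ : ℝ} (hσ : 0 < σ) (hσ1 : σ ≤ 1)
    (h : σ * ∑ p ∈ q.primeFactors, Real.log p / p ≤ 1) :
    ∑' n : ℕ+, ENNReal.ofReal (if (n : ℕ).Coprime q then ((n : ℕ) : ℝ) ^ (-(1 + σ)) else 0) ≤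
      ENNReal.ofReal (2 * Real.exp 2 * ((q.totient : ℝ) / q) / σ) := by
  have hs := hasSum_rpow_sifted (show 1 < 1 + σ by linarith) q.primeFactors
    fun p hp => Nat.prime_of_mem_primeFactors hp
  simp_rw [← coprime_iff_forall_primeFactors hq] at hs
  refine (ENNReal.tsum_comp_le_tsum_of_injective PNat.coe_injective
    fun n : ℕ => ENNReal.ofReal (if n.Coprime q then (n : ℝ) ^ (-(1 + σ)) else 0)).trans ?_
  rw [← ENNReal.ofReal_tsum_of_nonneg _ hs.summable, hs.tsum_eq]
  swap
  · intro n; positivity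
  refine ENNReal.ofReal_le_ofReal ?_
  have h1 : ∏ p ∈ q.primeFactors, (1 - (p : ℝ) ^ (-(1 + σ))) ≤
      (q.totient : ℝ) / q * Real.exp 2 := by
    calc _ ≤ ∏ p ∈ q.primeFactors,
          ((1 - 1 / (p : ℝ)) * Real.exp (2 * (σ * Real.log p) / p)) := by
          refine Finset.prod_le_prod (fun p hp => ?_) fun p hp => ?_
          · have : (1 : ℝ) ≤ p := by exact_mod_cast (Nat.prime_of_mem_primeFactors hp).one_le
            have := Real.rpow_le_one_of_one_le_of_nonpos this (by linarith : -(1 + σ) ≤ 0)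
            linarith
          · exact one_sub_rpow_le
              (by exact_mod_cast (Nat.prime_of_mem_primeFactors hp).two_le) hσ
      _ ≤ _ := by
          rw [Finset.prod_mul_distrib, ← totient_div_eq_prod hq, ← Real.exp_sum]
          gcongr
          calc _ = 2 * (σ * ∑ p ∈ q.primeFactors, Real.log p / p) := by
                simp_rw [Finset.mul_sum]
                exact Finset.sum_congr rfl fun p _ => by ring
            _ ≤ 2 := by linarith
  have h2 : ∑' n : ℕ, (n : ℝ) ^ (-(1 + σ)) ≤ 2 / σ := by
    refine (tsum_rpow_le hσ).trans ?_
    have : 1 ≤ 1 / σ := (one_le_div hσ).2 hσ1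
    rw [show 2 / σ = 1 / σ + 1 / σ by ring]
    linarith
  calc _ ≤ (q.totient : ℝ) / q * Real.exp 2 * (2 / σ) :=
        mul_le_mul h1 h2 (tsum_nonneg fun n => by positivity) (by positivity)
    _ = _ := by ring

open scoped Classical in
theorem abs_card_sifted_sub_le (P : Finset ℕ) (hP : ∀ p ∈ P, p.Prime) {x : ℝ} (hx : 0 ≤ x) :
    |(({n ∈ Finset.Icc 1 ⌊x⌋₊ | ∀ p ∈ P, ¬ p ∣ n}.card : ℕ) : ℝ) -
      (∏ p ∈ P, (1 - 1 / (p : ℝ))) * x| ≤ 2 ^ P.card := by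
  induction P using Finset.induction_on generalizing x with
  | empty =>
    have h1 := Nat.floor_le hx
    have h2 := Nat.lt_floor_add_one x
    simp only [Finset.notMem_empty, false_imp_iff, implies_true, Finset.filter_true,
      Nat.card_Icc, add_tsub_cancel_right, Finset.prod_empty, one_mul, Finset.card_empty, pow_zero]
    rw [abs_le]
    constructor <;> linarith
  | insert p P hp ih =>
    have hpp := hP p (Finset.mem_insert_self p P)
    have hP' : ∀ r ∈ P, r.Prime := fun r hr => hP r (Finset.mem_insert_of_mem hr)
    have h1 := ih hP' hx
    have h2 := ih hP' (show 0 ≤ x / p by positivity)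
    have hcard : {n ∈ Finset.Icc 1 ⌊x⌋₊ | ∀ r ∈ P, ¬ r ∣ n}.card =
        {n ∈ Finset.Icc 1 ⌊x⌋₊ | ∀ r ∈ insert p P, ¬ r ∣ n}.card +
        {n ∈ Finset.Icc 1 ⌊x / p⌋₊ | ∀ r ∈ P, ¬ r ∣ n}.card := by
      have himg : {n ∈ {n ∈ Finset.Icc 1 ⌊x⌋₊ | ∀ r ∈ P, ¬ r ∣ n} | p ∣ n} =
          {n ∈ Finset.Icc 1 ⌊x / p⌋₊ | ∀ r ∈ P, ¬ r ∣ n}.image (fun m => p * m) := by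
        ext n
        simp only [Finset.mem_filter, Finset.mem_Icc, Finset.mem_image, Nat.floor_div_natCast]
        constructor
        · rintro ⟨⟨⟨hn1, hn2⟩, hn3⟩, m, rfl⟩
          refine ⟨m, ⟨⟨Nat.pos_of_mul_pos_left hn1, ?_⟩,
            (forall_not_dvd_prime_mul_iff hpp hp hP' m).1 hn3⟩, rfl⟩
          rw [Nat.le_div_iff_mul_le hpp.pos, mul_comm]
          exact hn2
        · rintro ⟨m, ⟨⟨hm1, hm2⟩, hm3⟩, rfl⟩
          rw [Nat.le_div_iff_mul_le hpp.pos, mul_comm] at hm2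
          exact ⟨⟨⟨Nat.mul_pos hpp.pos hm1, hm2⟩,
            (forall_not_dvd_prime_mul_iff hpp hp hP' m).2 hm3⟩, dvd_mul_right _ _⟩
      rw [← Finset.card_filter_add_card_filter_not (fun n => p ∣ n), himg,
        Finset.card_image_of_injective _ fun a b h => Nat.eq_of_mul_eq_mul_left hpp.pos h,
        add_comm, Finset.filter_filter]
      congr 3
      ext n
      simp [and_comm]
    have hcard' := congrArg (fun k : ℕ => (k : ℝ)) hcard
    simp only [Nat.cast_add] at hcard'
    rw [abs_le] at h1 h2 ⊢
    rw [Finset.prod_insert hp, Finset.card_insert_of_notMem hp, pow_succ]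
    have e : (1 - 1 / (p : ℝ)) * (∏ r ∈ P, (1 - 1 / (r : ℝ))) * x =
        (∏ r ∈ P, (1 - 1 / (r : ℝ))) * x - (∏ r ∈ P, (1 - 1 / (r : ℝ))) * (x / p) := by ring
    rw [e]
    constructor <;> linarith

theorem inv_two_pow_le_totient_div {q : ℕ} (hq : q ≠ 0) :
    ((2 : ℝ) ^ q.primeFactors.card)⁻¹ ≤ (q.totient : ℝ) / q := by
  rw [totient_div_eq_prod hq, ← inv_pow, ← Finset.prod_const]
  refine Finset.prod_le_prod (fun _ _ => by norm_num) fun p hp => ?_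
  have h2 : (2 : ℝ) ≤ p := by exact_mod_cast (Nat.prime_of_mem_primeFactors hp).two_le
  have := one_div_le_one_div_of_le (by norm_num) h2
  norm_num at this ⊢
  linarith

theorem card_coprime_le {q : ℕ} (hq : q ≠ 0) {x : ℝ} (hx : 4 ^ q.primeFactors.card ≤ x) :
    (({n ∈ Finset.Icc 1 ⌊x⌋₊ | n.Coprime q}.card : ℕ) : ℝ) ≤ 2 * ((q.totient : ℝ) / q) * x := by
  classical
  have hx0 : 0 ≤ x := le_trans (by positivity) hx
  have h := (abs_le.1 (abs_card_sifted_sub_le q.primeFactors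
    (fun p hp => Nat.prime_of_mem_primeFactors hp) hx0)).2
  simp_rw [← coprime_iff_forall_primeFactors hq, ← totient_div_eq_prod hq] at h
  have h3 : (2 : ℝ) ^ q.primeFactors.card ≤ (q.totient : ℝ) / q * x := by
    calc (2 : ℝ) ^ q.primeFactors.card
        = ((2 : ℝ) ^ q.primeFactors.card)⁻¹ * 4 ^ q.primeFactors.card := by
          rw [show (4 : ℝ) = 2 * 2 by norm_num, mul_pow]
          field_simp
      _ ≤ _ := by
          gcongr
          exact inv_two_pow_le_totient_div hq
  rw [sub_le_iff_le_add] at h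
  refine le_trans (le_of_eq ?_) (h.trans (by linarith))
  congr!

theorem one_add_inv_le_rpow {t σ : ℝ} (ht : 0 < t) (hσ : 0 ≤ σ) (hσ1 : σ ≤ 1) :
    (1 + t)⁻¹ ≤ t ^ (-σ) := by
  calc (1 + t)⁻¹ = (1 + t) ^ (-1 : ℝ) := (Real.rpow_neg_one _).symm
    _ ≤ (1 + t) ^ (-σ) := Real.rpow_le_rpow_of_exponent_le (by linarith) (by linarith)
    _ ≤ t ^ (-σ) := Real.rpow_le_rpow_of_nonpos ht (by linarith) (by linarith)

theorem tsum_coprime_small_le {q : ℕ} (hq : 2 ≤ q) {M : ℝ} (hM : 0 < M)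
    (hM' : M ≤ 36 ^ q.primeFactors.card) :
    ∑' g : ℕ+, ENNReal.ofReal (if (g : ℕ).Coprime q then
      1 / (g : ℝ) * (1 + (g : ℝ) ^ 2 / M)⁻¹ else 0) ≤
      ENNReal.ofReal (4 * Real.exp 3 * ((q.totient : ℝ) / q) * q.primeFactors.card) := by
  have hq0 : q ≠ 0 := by omega
  set w := q.primeFactors.card with hw
  have hw1 : (1 : ℝ) ≤ w := by
    have : 0 < w := Finset.card_pos.2 (Nat.nonempty_primeFactors.2 (by omega))
    exact_mod_cast this
  have hl1 : 1 ≤ Real.log 6 := by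
    rw [Real.le_log_iff_exp_le (by norm_num)]
    linarith [Real.exp_one_lt_d9]
  have hl2 : Real.log 6 ≤ 2 := by
    rw [Real.log_le_iff_le_exp (by norm_num), show (2 : ℝ) = 1 + 1 by norm_num, Real.exp_add]
    nlinarith [Real.exp_one_gt_d9]
  have hwl : 1 ≤ w * Real.log 6 := one_le_mul_of_one_le_of_one_le hw1 hl1
  set σ := (w * Real.log 6)⁻¹ with hσ
  have hσ0 : 0 < σ := by positivity
  have hσ1 : σ ≤ 1 := inv_le_one_of_one_le₀ hwl
  have hW : ((6 : ℝ) ^ w) ^ σ = Real.exp 1 := by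
    rw [Real.rpow_def_of_pos (by positivity), Real.log_pow, hσ, mul_inv_cancel₀ (by positivity)]
  have hsum : σ * ∑ p ∈ q.primeFactors, Real.log p / p ≤ 1 := by
    have : ∑ p ∈ q.primeFactors, Real.log p / p ≤ ∑ p ∈ q.primeFactors, (1 : ℝ) := by
      refine Finset.sum_le_sum fun p hp => ?_
      have hp0 : (0 : ℝ) < p := by exact_mod_cast (Nat.prime_of_mem_primeFactors hp).pos
      rw [div_le_one hp0]
      linarith [Real.log_le_sub_one_of_pos hp0]
    rw [Finset.sum_const, nsmul_one, ← hw] at this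
    calc σ * ∑ p ∈ q.primeFactors, Real.log p / p ≤ σ * (w * Real.log 6) := by
          gcongr
          nlinarith
      _ = 1 := inv_mul_cancel₀ (by positivity)
  have hterm : ∀ g : ℕ+, ENNReal.ofReal (if (g : ℕ).Coprime q then
      1 / (g : ℝ) * (1 + (g : ℝ) ^ 2 / M)⁻¹ else 0) ≤ ENNReal.ofReal (Real.exp 1) *
      ENNReal.ofReal (if (g : ℕ).Coprime q then ((g : ℕ) : ℝ) ^ (-(1 + σ)) else 0) := by
    intro g
    rw [← ENNReal.ofReal_mul (by positivity)]
    refine ENNReal.ofReal_le_ofReal ?_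
    split_ifs with h
    · have hg : (0 : ℝ) < g := by exact_mod_cast g.pos
      have h1 : (1 + (g : ℝ) ^ 2 / M)⁻¹ ≤ ((g : ℝ) / 6 ^ w) ^ (-σ) := by
        calc (1 + (g : ℝ) ^ 2 / M)⁻¹ ≤ (1 + (g : ℝ) ^ 2 / 36 ^ w)⁻¹ := by gcongr
          _ ≤ ((g : ℝ) ^ 2 / 36 ^ w) ^ (-(σ / 2)) :=
            one_add_inv_le_rpow (by positivity) (by positivity) (by linarith)
          _ = (((g : ℝ) / 6 ^ w) ^ (2 : ℝ)) ^ (-(σ / 2)) := by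
            congr 1
            rw [Real.rpow_two, div_pow, ← pow_mul, mul_comm w 2, pow_mul]
            norm_num
          _ = _ := by
            rw [← Real.rpow_mul (by positivity)]
            congr 1
            ring
      have h2 : ((g : ℝ) / 6 ^ w) ^ (-σ) = Real.exp 1 * (g : ℝ) ^ (-σ) := by
        rw [Real.div_rpow (by positivity) (by positivity),
          Real.rpow_neg (show (0 : ℝ) ≤ 6 ^ w by positivity), hW]
        field_simp
      rw [h2] at h1
      rw [neg_add, Real.rpow_add hg, Real.rpow_neg_one, one_div]
      calc (g : ℝ)⁻¹ * (1 + (g : ℝ) ^ 2 / M)⁻¹ ≤ (g : ℝ)⁻¹ * (Real.exp 1 * (g : ℝ) ^ (-σ)) := by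
            gcongr
        _ = _ := by ring
    · simp
  refine (ENNReal.tsum_le_tsum hterm).trans ?_
  rw [ENNReal.tsum_mul_left]
  refine (mul_le_mul_right (tsum_coprime_rpow_le hq0 hσ0 hσ1 hsum) _).trans ?_
  rw [← ENNReal.ofReal_mul (by positivity)]
  refine ENNReal.ofReal_le_ofReal ?_
  have h3 : Real.exp 3 = Real.exp 1 * Real.exp 2 := by rw [← Real.exp_add]; norm_num
  calc _ = 2 * Real.exp 3 * ((q.totient : ℝ) / q) * w * Real.log 6 := by
        rw [hσ, h3, div_inv_eq_mul]
        ring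
    _ ≤ 2 * Real.exp 3 * ((q.totient : ℝ) / q) * w * 2 := by gcongr
    _ = _ := by ring

theorem tsum_pnat_ite_mem_le (s : Finset ℕ) (c : ENNReal) :
    ∑' g : ℕ+, (if (g : ℕ) ∈ s then c else 0) ≤ s.card * c := by
  refine (ENNReal.tsum_comp_le_tsum_of_injective PNat.coe_injective
    fun n : ℕ => if n ∈ s then c else 0).trans (le_of_eq ?_)
  rw [tsum_eq_sum (s := s) fun n hn => if_neg hn, Finset.sum_congr rfl fun n hn => if_pos hn,
    Finset.sum_const, nsmul_eq_mul]

theorem tsum_coprime_le_const_le {q : ℕ} (hq : q ≠ 0) {x c : ℝ}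
    (hx : 4 ^ q.primeFactors.card ≤ x) :
    ∑' g : ℕ+, (if (g : ℕ).Coprime q ∧ (g : ℝ) ≤ x then ENNReal.ofReal c else 0) ≤
      ENNReal.ofReal (2 * ((q.totient : ℝ) / q) * x) * ENNReal.ofReal c := by
  have hle : ∀ g : ℕ+, (if (g : ℕ).Coprime q ∧ (g : ℝ) ≤ x then ENNReal.ofReal c else 0) ≤
      if (g : ℕ) ∈ {n ∈ Finset.Icc 1 ⌊x⌋₊ | n.Coprime q} then ENNReal.ofReal c else 0 := by
    intro g
    by_cases h : (g : ℕ).Coprime q ∧ (g : ℝ) ≤ x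
    · rw [if_pos h, if_pos]
      exact Finset.mem_filter.2 ⟨Finset.mem_Icc.2 ⟨g.pos, Nat.le_floor h.2⟩, h.1⟩
    · rw [if_neg h]
      exact zero_le
  refine (ENNReal.tsum_le_tsum hle).trans ((tsum_pnat_ite_mem_le _ _).trans ?_)
  gcongr
  rw [← ENNReal.ofReal_natCast]
  exact ENNReal.ofReal_le_ofReal (card_coprime_le hq hx)

theorem tsum_inv_one_add_four_pow_le (w : ℕ) :
    ∑' j : ℕ, ENNReal.ofReal ((1 + (4 : ℝ) ^ j / 2 ^ w)⁻¹) ≤ ENNReal.ofReal (w + 2) := by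
  have hle : ∀ j : ℕ, ENNReal.ofReal ((1 + (4 : ℝ) ^ j / 2 ^ w)⁻¹) ≤
      (if j ∈ Finset.range w then 1 else 0) + ENNReal.ofReal ((1 / 2) ^ j) := by
    intro j
    by_cases h : j ∈ Finset.range w
    · rw [if_pos h]
      refine le_add_right ?_
      rw [ENNReal.ofReal_le_one]
      exact inv_le_one_of_one_le₀ (by linarith [show 0 ≤ (4 : ℝ) ^ j / 2 ^ w by positivity])
    · rw [if_neg h, zero_add]
      refine ENNReal.ofReal_le_ofReal ?_
      rw [Finset.mem_range, not_lt] at h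
      rw [one_div, inv_pow]
      refine inv_anti₀ (by positivity) ?_
      have : (2 : ℝ) ^ j ≤ 4 ^ j / 2 ^ w := by
        rw [le_div_iff₀ (by positivity), show (4 : ℝ) = 2 * 2 by norm_num, mul_pow]
        gcongr
        norm_num
      linarith
  refine (ENNReal.tsum_le_tsum hle).trans ?_
  rw [ENNReal.tsum_add, tsum_eq_sum (s := Finset.range w) fun n hn => if_neg hn,
    Finset.sum_congr rfl fun n hn => if_pos hn, Finset.sum_const, nsmul_eq_mul, mul_one,
    Finset.card_range, ← ENNReal.ofReal_tsum_of_nonneg (fun n => by positivity)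
      summable_geometric_two, tsum_geometric_two, ← ENNReal.ofReal_natCast,
    ← ENNReal.ofReal_add (by positivity) (by positivity)]

theorem tsum_coprime_large_le {q : ℕ} (hq : 2 ≤ q) {M : ℝ}
    (hM : 36 ^ q.primeFactors.card ≤ M) :
    ∑' g : ℕ+, ENNReal.ofReal (if (g : ℕ).Coprime q ∧ M / 2 ^ q.primeFactors.card < (g : ℝ) ^ 2
      then 1 / (g : ℝ) * (1 + (g : ℝ) ^ 2 / M)⁻¹ else 0) ≤
      ENNReal.ofReal (12 * ((q.totient : ℝ) / q) * q.primeFactors.card) := by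
  have hq0 : q ≠ 0 := by omega
  set w := q.primeFactors.card with hw
  have hw1 : (1 : ℝ) ≤ w := by
    have : 0 < w := Finset.card_pos.2 (Nat.nonempty_primeFactors.2 (by omega))
    exact_mod_cast this
  have hM0 : 0 < M := lt_of_lt_of_le (by positivity) hM
  set X := √(M / 2 ^ w) with hX
  have hXsq : X ^ 2 = M / 2 ^ w := Real.sq_sqrt (by positivity)
  have hX4 : 4 ^ w ≤ X := by
    refine Real.le_sqrt_of_sq_le ?_
    rw [le_div_iff₀ (by positivity), ← pow_mul, mul_comm w 2, pow_mul, ← mul_pow]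
    refine le_trans ?_ hM
    gcongr
    norm_num
  have hX0 : 0 < X := lt_of_lt_of_le (by positivity) hX4
  set c : ℕ → ℝ := fun j => (1 + (4 : ℝ) ^ j / 2 ^ w)⁻¹ / (2 ^ j * X) with hc
  have hle : ∀ g : ℕ+, ENNReal.ofReal (if (g : ℕ).Coprime q ∧ M / 2 ^ w < (g : ℝ) ^ 2
      then 1 / (g : ℝ) * (1 + (g : ℝ) ^ 2 / M)⁻¹ else 0) ≤
      ∑' j : ℕ, if (g : ℕ).Coprime q ∧ (g : ℝ) ≤ 2 ^ (j + 1) * X then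
        ENNReal.ofReal (c j) else 0 := by
    intro g
    split_ifs with h
    · have hg : (0 : ℝ) < g := by exact_mod_cast g.pos
      have hXg : 1 ≤ (g : ℝ) / X := by
        rw [one_le_div hX0]
        rw [← hXsq] at h
        exact (lt_of_pow_lt_pow_left₀ 2 hg.le h.2).le
      obtain ⟨j, hj1, hj2⟩ := exists_nat_pow_near hXg (one_lt_two)
      rw [le_div_iff₀ hX0] at hj1
      rw [div_lt_iff₀ hX0] at hj2
      refine le_trans ?_ (ENNReal.le_tsum j)
      rw [if_pos ⟨h.1, hj2.le⟩]
      refine ENNReal.ofReal_le_ofReal ?_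
      have h4 : (4 : ℝ) ^ j / 2 ^ w ≤ (g : ℝ) ^ 2 / M := by
        rw [le_div_iff₀ hM0]
        calc (4 : ℝ) ^ j / 2 ^ w * M = 4 ^ j * X ^ 2 := by rw [hXsq]; ring
          _ = (2 ^ j * X) ^ 2 := by
            rw [mul_pow, ← pow_mul, mul_comm j 2, pow_mul]
            norm_num
          _ ≤ _ := by gcongr
      calc 1 / (g : ℝ) * (1 + (g : ℝ) ^ 2 / M)⁻¹
          ≤ 1 / (2 ^ j * X) * (1 + (4 : ℝ) ^ j / 2 ^ w)⁻¹ := by gcongr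
        _ = c j := by rw [hc]; ring
    · rw [ENNReal.ofReal_zero]
      exact zero_le
  refine (ENNReal.tsum_le_tsum hle).trans ?_
  rw [ENNReal.tsum_comm]
  have hle2 : ∀ j : ℕ, (∑' g : ℕ+, if (g : ℕ).Coprime q ∧ (g : ℝ) ≤ 2 ^ (j + 1) * X then
        ENNReal.ofReal (c j) else 0) ≤
      ENNReal.ofReal (4 * ((q.totient : ℝ) / q)) *
        ENNReal.ofReal ((1 + (4 : ℝ) ^ j / 2 ^ w)⁻¹) := by
    intro j
    have h1 : (4 : ℝ) ^ w ≤ 2 ^ (j + 1) * X :=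
      hX4.trans (le_mul_of_one_le_left hX0.le (one_le_pow₀ one_le_two))
    refine (tsum_coprime_le_const_le hq0 h1).trans ?_
    rw [← ENNReal.ofReal_mul (by positivity), ← ENNReal.ofReal_mul (by positivity)]
    refine ENNReal.ofReal_le_ofReal (le_of_eq ?_)
    rw [hc]
    field_simp
    ring
  refine (ENNReal.tsum_le_tsum hle2).trans ?_
  rw [ENNReal.tsum_mul_left]
  refine (mul_le_mul_right (tsum_inv_one_add_four_pow_le w) _).trans ?_
  rw [← ENNReal.ofReal_mul (by positivity)]
  refine ENNReal.ofReal_le_ofReal ?_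
  calc _ ≤ 4 * ((q.totient : ℝ) / q) * (w + 2 * w) := by gcongr; linarith
    _ = _ := by ring

theorem tsum_coprime_weighted_le {q : ℕ} (hq : 2 ≤ q) {M : ℝ} (hM : 0 < M) :
    ∑' g : ℕ+, ENNReal.ofReal (if (g : ℕ).Coprime q ∧ M / 2 ^ q.primeFactors.card < (g : ℝ) ^ 2
      then 1 / (g : ℝ) * (1 + (g : ℝ) ^ 2 / M)⁻¹ else 0) ≤
      ENNReal.ofReal (4 * Real.exp 3 * ((q.totient : ℝ) / q) * q.primeFactors.card) := by
  rcases le_total M (36 ^ q.primeFactors.card) with h | h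
  · refine (ENNReal.tsum_le_tsum fun g => ENNReal.ofReal_le_ofReal ?_).trans
      (tsum_coprime_small_le hq hM h)
    by_cases hg : (g : ℕ).Coprime q
    · rw [if_pos hg]
      split_ifs
      · rfl
      · positivity
    · rw [if_neg hg, if_neg fun h => hg h.1]
  · refine (tsum_coprime_large_le hq h).trans (ENNReal.ofReal_le_ofReal ?_)
    gcongr
    linarith [Real.add_one_le_exp 3]

theorem exists_factorization_of_mul_eq_mul {a b c d : ℕ+} (h : (a : ℕ) * c = b * d) :
    ∃ r s g m : ℕ+, a = g * r ∧ b = g * s ∧ c = s * m ∧ d = r * m := by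
  obtain ⟨g, r, ⟨s, hs⟩, ⟨m, hm⟩, har⟩ :=
    exists_dvd_and_dvd_of_dvd_mul (Dvd.intro (c : ℕ) h)
  have hg : 0 < g := Nat.pos_of_mul_pos_right (har ▸ a.pos)
  have hr : 0 < r := Nat.pos_of_mul_pos_left (har ▸ a.pos)
  have hs0 : 0 < s := Nat.pos_of_mul_pos_left (hs ▸ b.pos)
  have hm0 : 0 < m := Nat.pos_of_mul_pos_left (hm ▸ d.pos)
  refine ⟨⟨r, hr⟩, ⟨s, hs0⟩, ⟨g, hg⟩, ⟨m, hm0⟩, PNat.eq har, PNat.eq hs, PNat.eq ?_, PNat.eq hm⟩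
  change (c : ℕ) = s * m
  rw [har, hs, hm] at h
  refine Nat.eq_of_mul_eq_mul_left (Nat.mul_pos hg hr) (h.trans ?_)
  ring

/-- The map `(r, s, g, m) ↦ (gr, gs, sm, rm)`, which parametrizes the solutions of `ac = bd`. -/
def quadrupleOfFactors (x : ℕ+ × ℕ+ × ℕ+ × ℕ+) : ℕ+ × ℕ+ × ℕ+ × ℕ+ :=
  (x.2.2.1 * x.1, x.2.2.1 * x.2.1, x.2.1 * x.2.2.2, x.1 * x.2.2.2)

theorem tsum_le_tsum_comp_quadrupleOfFactors (F : ℕ+ × ℕ+ × ℕ+ × ℕ+ → ENNReal)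
    (hF : ∀ p, F p ≠ 0 → (p.1 : ℕ) * p.2.2.1 = p.2.1 * p.2.2.2) :
    ∑' p, F p ≤ ∑' x, F (quadrupleOfFactors x) := by
  have hsub : Function.support F ⊆ Set.range quadrupleOfFactors := by
    rintro ⟨a, b, c, d⟩ hp
    obtain ⟨r, s, g, m, rfl, rfl, rfl, rfl⟩ := exists_factorization_of_mul_eq_mul (hF _ hp)
    exact ⟨(r, s, g, m), rfl⟩
  rw [← tsum_subtype_eq_of_support_subset hsub]
  exact ENNReal.tsum_le_tsum_comp_of_surjective
    (Set.rangeFactorization_surjective (f := quadrupleOfFactors)) fun p => F p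

theorem weight_le {N r s g m σ : ℝ} (hN : 1 < N) (hr : 1 ≤ r) (hs : 1 ≤ s) (hg : 1 ≤ g)
    (hm : 1 ≤ m) (hσ : σ = (Real.log N)⁻¹) (hσ1 : σ ≤ 1) :
    1 / √(g * r * (g * s) * (s * m) * (r * m)) * (1 + g * r * (g * s) / N) ^ (-2 : ℤ) *
      (1 + s * m * (r * m) / N) ^ (-2 : ℤ) ≤
    Real.exp 1 * (r ^ (-(1 + σ)) * s ^ (-(1 + σ))) *
      (1 / g * (1 + g ^ 2 / (N / (r * s)))⁻¹ * (1 / m * (1 + m ^ 2 / (N / (r * s)))⁻¹)) := by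
  have hN0 : 0 < N := by linarith
  have hr0 : 0 < r := by linarith
  have hs0 : 0 < s := by linarith
  have hg0 : 0 < g := by linarith
  have hm0 : 0 < m := by linarith
  have hlog := Real.log_pos hN
  have hσ0 : 0 < σ := hσ ▸ inv_pos.2 hlog
  have hsqrt : √(g * r * (g * s) * (s * m) * (r * m)) = g * m * (r * s) := by
    rw [show g * r * (g * s) * (s * m) * (r * m) = (g * m * (r * s)) ^ 2 by ring]
    exact Real.sqrt_sq (by positivity)
  set t := r * s / N with ht
  have ht0 : 0 < t := by positivity
  have key : ∀ k : ℝ, 1 ≤ k → (1 + t * k ^ 2) ^ (-2 : ℤ) ≤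
      (1 + k ^ 2 / (N / (r * s)))⁻¹ * (1 + t)⁻¹ := by
    intro k hk
    have e : k ^ 2 / (N / (r * s)) = t * k ^ 2 := by rw [ht]; field_simp
    rw [e, zpow_neg, ← mul_inv]
    refine inv_anti₀ (by positivity) ?_
    rw [show ((2 : ℤ)) = ((2 : ℕ) : ℤ) by rfl, zpow_natCast, sq (1 + t * k ^ 2)]
    have : t ≤ t * k ^ 2 := le_mul_of_one_le_right ht0.le (one_le_pow₀ hk)
    exact mul_le_mul_of_nonneg_left (by linarith) (by positivity)
  have hσt : (1 + t)⁻¹ * (1 + t)⁻¹ ≤ Real.exp 1 * (r ^ (-σ) * s ^ (-σ)) := by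
    calc (1 + t)⁻¹ * (1 + t)⁻¹ ≤ 1 * (1 + t)⁻¹ := by
          gcongr
          exact inv_le_one_of_one_le₀ (by linarith)
      _ ≤ t ^ (-σ) := by
          rw [one_mul]
          exact one_add_inv_le_rpow ht0 hσ0.le hσ1
      _ = _ := by
          rw [ht, Real.div_rpow (by positivity) hN0.le, Real.mul_rpow hr0.le hs0.le,
            Real.rpow_neg hN0.le σ, Real.rpow_def_of_pos hN0, hσ, mul_inv_cancel₀ hlog.ne']
          field_simp
  have h1 := key g hg
  have h2 := key m hm
  rw [hsqrt, show g * r * (g * s) / N = t * g ^ 2 by rw [ht]; ring,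
    show s * m * (r * m) / N = t * m ^ 2 by rw [ht]; ring]
  have hrσ : ∀ k : ℝ, 0 < k → k ^ (-(1 + σ)) = k⁻¹ * k ^ (-σ) := by
    intro k hk
    rw [neg_add, Real.rpow_add hk, Real.rpow_neg_one]
  rw [hrσ r hr0, hrσ s hs0]
  set A := (1 + g ^ 2 / (N / (r * s)))⁻¹
  set B := (1 + m ^ 2 / (N / (r * s)))⁻¹
  have hA : 0 ≤ A := by positivity
  have hB : 0 ≤ B := by positivity
  calc 1 / (g * m * (r * s)) * (1 + t * g ^ 2) ^ (-2 : ℤ) * (1 + t * m ^ 2) ^ (-2 : ℤ)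
      ≤ 1 / (g * m * (r * s)) * (A * (1 + t)⁻¹) * (B * (1 + t)⁻¹) := by gcongr
    _ = 1 / (g * m * (r * s)) * A * B * ((1 + t)⁻¹ * (1 + t)⁻¹) := by ring
    _ ≤ 1 / (g * m * (r * s)) * A * B * (Real.exp 1 * (r ^ (-σ) * s ^ (-σ))) := by gcongr
    _ = _ := by ring

theorem sum_log_div_le_log {q : ℕ} (hq : q ≠ 0) :
    ∑ p ∈ q.primeFactors, Real.log p / p ≤ Real.log q := by
  calc ∑ p ∈ q.primeFactors, Real.log p / p ≤ ∑ p ∈ q.primeFactors, Real.log p := by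
        refine Finset.sum_le_sum fun p hp => ?_
        have h1 : (1 : ℝ) ≤ p := by exact_mod_cast (Nat.prime_of_mem_primeFactors hp).one_le
        exact div_le_self (Real.log_nonneg h1) h1
    _ = Real.log (∏ p ∈ q.primeFactors, (p : ℝ)) := by
        rw [Real.log_prod]
        intro p hp
        exact_mod_cast (Nat.prime_of_mem_primeFactors hp).ne_zero
    _ ≤ Real.log q := by
        rw [← Nat.cast_prod]
        refine Real.log_le_log ?_ ?_
        · exact_mod_cast Finset.prod_pos fun p hp => (Nat.prime_of_mem_primeFactors hp).pos
        · exact_mod_cast Nat.le_of_dvd (Nat.pos_of_ne_zero hq) (Nat.prod_primeFactors_dvd q)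

/-- For `q, T ≥ 2` and `Z = qT/2^{ω(q)}`,
`R₁ ≪ qT (φ(q)/q)⁵ ω(q)² (log qT)² + φ(q) T log qT`, with an absolute implied constant. -/
theorem fourth_moment_R1_bound :
    ∃ C : ℝ, 0 < C ∧ ∀ (q : ℕ), 2 ≤ q → ∀ (T : ℝ), 2 ≤ T →
      R1 q (q * T / 2 ^ q.primeFactors.card) T ≤
        C * ((q : ℝ) * T * ((q.totient : ℝ) / q) ^ 5 * (q.primeFactors.card : ℝ) ^ 2 *
              Real.log (q * T) ^ 2 +
            (q.totient : ℝ) * T * Real.log (q * T)) := by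
  refine ⟨Real.exp 1 * (2 * Real.exp 2) ^ 2 * (4 * Real.exp 3) ^ 2, by positivity, ?_⟩
  intro q hq T hT
  have hq0 : q ≠ 0 := by omega
  have hq2 : (2 : ℝ) ≤ q := by exact_mod_cast hq
  set N := (q : ℝ) * T with hN
  have hN4 : 4 ≤ N := by nlinarith
  have hN0 : 0 < N := by linarith
  set L := Real.log N with hL
  have hL1 : 1 ≤ L := by
    rw [hL, Real.le_log_iff_exp_le hN0]
    linarith [Real.exp_one_lt_d9]
  set σ := L⁻¹ with hσ
  have hσ0 : 0 < σ := by positivity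
  have hσ1 : σ ≤ 1 := inv_le_one_of_one_le₀ hL1
  set f := (q.totient : ℝ) / q with hf
  have hf0 : 0 ≤ f := by positivity
  set w := q.primeFactors.card with hw
  set H := ENNReal.ofReal (4 * Real.exp 3 * f * w) with hH
  set G := ENNReal.ofReal (2 * Real.exp 2 * f * L) with hG
  let ρ : ℕ+ → ENNReal := fun r =>
    ENNReal.ofReal (if (r : ℕ).Coprime q then ((r : ℕ) : ℝ) ^ (-(1 + σ)) else 0)
  let u : ℝ → ℕ+ → ENNReal := fun M g => ENNReal.ofReal
    (if (g : ℕ).Coprime q ∧ M / 2 ^ w < (g : ℝ) ^ 2 then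
      1 / (g : ℝ) * (1 + (g : ℝ) ^ 2 / M)⁻¹ else 0)
  have hρ : ∑' r, ρ r ≤ G := by
    have h1 : σ * ∑ p ∈ q.primeFactors, Real.log p / p ≤ 1 := by
      have h2 : Real.log q ≤ L := Real.log_le_log (by linarith) (by nlinarith)
      calc _ ≤ σ * L := by
            gcongr
            exact (sum_log_div_le_log hq0).trans h2
        _ = 1 := inv_mul_cancel₀ (by positivity)
    have h3 := tsum_coprime_rpow_le hq0 hσ0 hσ1 h1
    rwa [hσ, div_inv_eq_mul] at h3
  have hu : ∀ M, 0 < M → ∑' g, u M g ≤ H := fun M hM => tsum_coprime_weighted_le hq hM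
  rw [R1]
  set Fr : ℕ+ × ℕ+ × ℕ+ × ℕ+ → ℝ := fun p =>
      let a : ℕ := p.1; let b : ℕ := p.2.1; let c : ℕ := p.2.2.1; let d : ℕ := p.2.2.2
      if N / 2 ^ w < ((a * b : ℕ) : ℝ) ∧ N / 2 ^ w < ((c * d : ℕ) : ℝ) ∧
          a * c = b * d ∧ Nat.gcd (a * b * c * d) q = 1 then
        1 / Real.sqrt (a * b * c * d) *
          (1 + ((a * b : ℕ) : ℝ) / N) ^ (-2 : ℤ) *
          (1 + ((c * d : ℕ) : ℝ) / N) ^ (-2 : ℤ)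
      else 0 with hFr
  have hFr0 : ∀ p, 0 ≤ Fr p := fun p => by
    simp only [hFr]
    positivity
  have hterm : ∀ r s g m : ℕ+, ENNReal.ofReal (Fr (quadrupleOfFactors (r, s, g, m))) ≤
      ENNReal.ofReal (Real.exp 1) * (ρ r * ρ s) * (u (N / (r * s)) g * u (N / (r * s)) m) := by
    intro r s g m
    have one_le : ∀ k : ℕ+, (1 : ℝ) ≤ k := fun k => by exact_mod_cast k.pos
    by_cases h : N / 2 ^ w < (((g * r : ℕ+) * (g * s : ℕ+) : ℕ) : ℝ) ∧
        N / 2 ^ w < (((s * m : ℕ+) * (r * m : ℕ+) : ℕ) : ℝ) ∧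
        ((g * r : ℕ+) : ℕ) * (s * m : ℕ+) = (g * s : ℕ+) * (r * m : ℕ+) ∧
        Nat.gcd ((g * r : ℕ+) * (g * s : ℕ+) * (s * m : ℕ+) * (r * m : ℕ+)) q = 1
    · have hval : Fr (quadrupleOfFactors (r, s, g, m)) =
          1 / √((g : ℝ) * r * (g * s) * (s * m) * (r * m)) *
          (1 + (g : ℝ) * r * (g * s) / N) ^ (-2 : ℤ) *
          (1 + (s : ℝ) * m * (r * m) / N) ^ (-2 : ℤ) := by
        simp only [hFr, quadrupleOfFactors]
        rw [if_pos h]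
        push_cast
        rfl
      obtain ⟨h1, h2, -, h4⟩ := h
      simp only [PNat.mul_coe, ← Nat.coprime_iff_gcd_eq_one, Nat.coprime_mul_iff_left] at h4
      obtain ⟨⟨⟨⟨cg, cr⟩, -, cs⟩, -, cm⟩, -⟩ := h4
      push_cast at h1 h2
      have hr0 : (0 : ℝ) < r := by linarith [one_le r]
      have hs0 : (0 : ℝ) < s := by linarith [one_le s]
      have hg : N / (r * s) / 2 ^ w < (g : ℝ) ^ 2 := by
        rw [div_right_comm, div_lt_iff₀ (by positivity)]
        linarith
      have hm : N / (r * s) / 2 ^ w < (m : ℝ) ^ 2 := by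
        rw [div_right_comm, div_lt_iff₀ (by positivity)]
        linarith
      simp only [ρ, u]
      rw [if_pos cr, if_pos cs, if_pos ⟨cg, hg⟩, if_pos ⟨cm, hm⟩,
        ← ENNReal.ofReal_mul (by positivity), ← ENNReal.ofReal_mul (by positivity),
        ← ENNReal.ofReal_mul (by positivity), ← ENNReal.ofReal_mul (by positivity)]
      rw [hval]
      exact ENNReal.ofReal_le_ofReal (weight_le (by linarith) (one_le r) (one_le s) (one_le g)
        (one_le m) hσ hσ1)
    · simp only [hFr, quadrupleOfFactors]
      rw [if_neg h, ENNReal.ofReal_zero]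
      exact zero_le
  have hsum : ∑' p, ENNReal.ofReal (Fr p) ≤ ENNReal.ofReal (Real.exp 1) * (G * G) * (H * H) := by
    calc ∑' p, ENNReal.ofReal (Fr p)
        ≤ ∑' x, ENNReal.ofReal (Fr (quadrupleOfFactors x)) := by
          refine tsum_le_tsum_comp_quadrupleOfFactors _ fun p hp => ?_
          by_contra hne
          refine hp ?_
          simp only [hFr]
          rw [if_neg fun h => hne h.2.2.1, ENNReal.ofReal_zero]
      _ = ∑' (r) (s) (g) (m), ENNReal.ofReal (Fr (quadrupleOfFactors (r, s, g, m))) := by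
          simp_rw [ENNReal.tsum_prod']
      _ ≤ ∑' (r) (s) (g) (m), ENNReal.ofReal (Real.exp 1) * (ρ r * ρ s) *
            (u (N / (r * s)) g * u (N / (r * s)) m) := by
          gcongr with r s g m
          exact hterm r s g m
      _ = ∑' (r) (s), ENNReal.ofReal (Real.exp 1) * (ρ r * ρ s) *
            ((∑' g, u (N / (r * s)) g) * ∑' m, u (N / (r * s)) m) := by
          simp_rw [ENNReal.tsum_mul_left, ENNReal.tsum_mul_right]
      _ ≤ ∑' (r) (s), ENNReal.ofReal (Real.exp 1) * (ρ r * ρ s) * (H * H) := by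
          gcongr with r s
          all_goals
            refine hu _ (div_pos hN0 (mul_pos ?_ ?_)) <;> exact_mod_cast PNat.pos _
      _ = ENNReal.ofReal (Real.exp 1) * ((∑' r, ρ r) * ∑' s, ρ s) * (H * H) := by
          simp_rw [ENNReal.tsum_mul_right, ENNReal.tsum_mul_left, ENNReal.tsum_mul_right]
      _ ≤ _ := by gcongr
  have htsum : ∑' p, Fr p ≤
      Real.exp 1 * (2 * Real.exp 2 * f * L) ^ 2 * (4 * Real.exp 3 * f * w) ^ 2 := by
    have h1 : ∑' p, Fr p = (∑' p, ENNReal.ofReal (Fr p)).toReal := by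
      rw [ENNReal.tsum_toReal_eq fun p => ENNReal.ofReal_ne_top]
      exact tsum_congr fun p => (ENNReal.toReal_ofReal (hFr0 p)).symm
    rw [h1]
    refine ENNReal.toReal_le_of_le_ofReal (by positivity) (hsum.trans (le_of_eq ?_))
    rw [hG, hH, ← ENNReal.ofReal_mul (by positivity), ← ENNReal.ofReal_mul (by positivity),
      ← ENNReal.ofReal_mul (by positivity), ← ENNReal.ofReal_mul (by positivity), pow_two, pow_two]
  have hφ : (q.totient : ℝ) = f * q := by rw [hf]; field_simp
  have hT0 : 0 ≤ T := by linarith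
  calc (q.totient : ℝ) * T * ∑' p, Fr p
      ≤ (q.totient : ℝ) * T *
        (Real.exp 1 * (2 * Real.exp 2 * f * L) ^ 2 * (4 * Real.exp 3 * f * w) ^ 2) := by gcongr
    _ = Real.exp 1 * (2 * Real.exp 2) ^ 2 * (4 * Real.exp 3) ^ 2 *
        (N * f ^ 5 * (w : ℝ) ^ 2 * L ^ 2 + 0) := by
      rw [hφ, hN]
      ring
    _ ≤ _ := by gcongr; positivity
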